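/- arXiv:1812.01092 — 4 statements merged into one kernel-verified Lean document; each statement's English description precedes it below -/
import Mathlib

section
/- Let X = (X_1,…,X_n) be a random vector, f = f(X) ∈ L^∞(ℙ), and d ≥ 2. Then pointwise, | 𝔥⁺ ( |𝔥^{(d−1)} f(X)|_op ) | ≤ | 𝔥^{(d)} f(X) |_op, where 𝔥⁺ is applied to the function x ↦ |𝔥^{(d−1)} f(x)|_op. -/
open MeasureTheory Finset Real Filter

noncomputable section

/-- Operator norm of a `k`-tensor indexed by tuples in `[n]^k`. -/
def tOp {n k : ℕ} (A : (Fin k → Fin n) → ℝ) : ℝ :=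
  ⨆ v : {v : Fin k → Fin n → ℝ // ∀ j, ∑ i, (v j i) ^ 2 ≤ 1},
    ∑ idx : Fin k → Fin n, (∏ j, v.1 j (idx j)) * A idx

/-- `k`-th order difference `𝔥_{i_1 … i_k} f` (L^∞ taken as sup over the involved coordinates). -/
def hOrd {n : ℕ} {𝒳 : Fin n → Type*} (f : (∀ i, 𝒳 i) → ℝ) (k : ℕ)
    (idx : Fin k → Fin n) (x : ∀ i, 𝒳 i) : ℝ :=
  ⨆ y : (∀ i, 𝒳 i) × (∀ i, 𝒳 i),
    |∑ S ∈ (Finset.univ : Finset (Fin k)).powerset, (-1 : ℝ) ^ S.card *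
      f (fun i => if i ∈ Finset.image idx S then y.2 i
                  else if i ∈ Finset.image idx Finset.univ then y.1 i else x i)|

/-- The `k`-tensor `𝔥^{(k)} f`. -/
def hT {n : ℕ} {𝒳 : Fin n → Type*} (f : (∀ i, 𝒳 i) → ℝ) (k : ℕ)
    (idx : Fin k → Fin n) (x : ∀ i, 𝒳 i) : ℝ :=
  if Function.Injective idx then hOrd f k idx x else 0

/-- First order difference `𝔥_i f` (sup over both replaced coordinates). -/
def hI {n : ℕ} {𝒳 : Fin n → Type*} (f : (∀ i, 𝒳 i) → ℝ) (i : Fin n) (x : ∀ j, 𝒳 j) : ℝ :=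
  ⨆ y : 𝒳 i × 𝒳 i, |f (Function.update x i y.1) - f (Function.update x i y.2)|

/-- `𝔥⁺_i f`. -/
def hPlusI {n : ℕ} {𝒳 : Fin n → Type*} (f : (∀ i, 𝒳 i) → ℝ) (i : Fin n) (x : ∀ j, 𝒳 j) : ℝ :=
  ⨆ y : 𝒳 i, max (f x - f (Function.update x i y)) 0

/-- `𝔥⁻_i f`. -/
def hMinusI {n : ℕ} {𝒳 : Fin n → Type*} (f : (∀ i, 𝒳 i) → ℝ) (i : Fin n) (x : ∀ j, 𝒳 j) : ℝ :=
  ⨆ y : 𝒳 i, max (f (Function.update x i y) - f x) 0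

/-- `L^p(μ)` norm. -/
def lpN {α : Type*} [MeasurableSpace α] (μ : Measure α) (p : ℝ) (g : α → ℝ) : ℝ :=
  (∫ x, |g x| ^ p ∂μ) ^ (1 / p)

/-- Entropy functional `Ent_μ(g)`. -/
def ent {α : Type*} [MeasurableSpace α] (μ : Measure α) (g : α → ℝ) : ℝ :=
  ∫ x, g x * Real.log (g x) ∂μ - (∫ x, g x ∂μ) * Real.log (∫ x, g x ∂μ)

/-- Variance with respect to a measure. -/
def cVar {β : Type*} [MeasurableSpace β] (ν : Measure β) (g : β → ℝ) : ℝ :=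
  ∫ y, (g y - ∫ y', g y' ∂ν) ^ 2 ∂ν

/-- `ν i x` is the conditional distribution of the `i`-th coordinate given the others. -/
def IsCondKernel {n : ℕ} {𝒳 : Fin n → Type*} [∀ i, MeasurableSpace (𝒳 i)]
    (μ : Measure (∀ i, 𝒳 i)) (ν : ∀ i, (∀ j, 𝒳 j) → Measure (𝒳 i)) : Prop :=
  (∀ i x, IsProbabilityMeasure (ν i x)) ∧
  (∀ i x x', (∀ j, j ≠ i → x j = x' j) → ν i x = ν i x') ∧
  (∀ i (g : (∀ j, 𝒳 j) → ℝ), Measurable g → (∃ M, ∀ x, |g x| ≤ M) →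
    ∫ x, ∫ y, g (Function.update x i y) ∂(ν i x) ∂μ = ∫ x, g x ∂μ)

/-- `|𝔡 f|²`. -/
def dSq {n : ℕ} {𝒳 : Fin n → Type*} [∀ i, MeasurableSpace (𝒳 i)]
    (ν : ∀ i, (∀ j, 𝒳 j) → Measure (𝒳 i)) (f : (∀ i, 𝒳 i) → ℝ) (x : ∀ i, 𝒳 i) : ℝ :=
  ∑ i, cVar (ν i x) (fun y => f (Function.update x i y))

/-- The `𝔡`-logarithmic Sobolev inequality with constant `σ2`. -/
def DLSI {n : ℕ} {𝒳 : Fin n → Type*} [∀ i, MeasurableSpace (𝒳 i)]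
    (μ : Measure (∀ i, 𝒳 i)) (ν : ∀ i, (∀ j, 𝒳 j) → Measure (𝒳 i)) (σ2 : ℝ) : Prop :=
  IsCondKernel μ ν ∧
  ∀ f : (∀ i, 𝒳 i) → ℝ, Measurable f → (∃ M, ∀ x, |f x| ≤ M) →
    ent μ (fun x => f x ^ 2) ≤ 2 * σ2 * ∫ x, dSq ν f x ∂μ

end

/-- Each form in the supremum defining `tOp` depends continuously on the vectors. -/
theorem continuous_tensorForm {n k : ℕ} (A : (Fin k → Fin n) → ℝ) :
    Continuous fun v : Fin k → Fin n → ℝ =>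
      ∑ idx : Fin k → Fin n, (∏ j, v j (idx j)) * A idx := by
  fun_prop

theorem isCompact_unitBallProduct (n k : ℕ) :
    IsCompact {v : Fin k → Fin n → ℝ | ∀ j, ∑ i, (v j i) ^ 2 ≤ 1} := by
  refine Metric.isCompact_of_isClosed_isBounded ?_ ?_
  · simp only [Set.ofPred_forall]
    exact isClosed_iInter fun j => isClosed_le (by fun_prop) continuous_const
  · refine (Metric.isBounded_closedBall (x := (0 : Fin k → Fin n → ℝ)) (r := 1)).subset ?_
    intro v hv
    rw [mem_closedBall_zero_iff, pi_norm_le_iff_of_nonneg zero_le_one]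
    intro j
    rw [pi_norm_le_iff_of_nonneg zero_le_one]
    intro i
    rw [Real.norm_eq_abs, ← sq_le_one_iff_abs_le_one]
    exact (single_le_sum (f := fun i => (v j i) ^ 2) (fun i _ => sq_nonneg _)
      (mem_univ i)).trans (hv j)

theorem le_tOp {n k : ℕ} (A : (Fin k → Fin n) → ℝ) (v : Fin k → Fin n → ℝ)
    (hv : ∀ j, ∑ i, (v j i) ^ 2 ≤ 1) :
    ∑ idx : Fin k → Fin n, (∏ j, v j (idx j)) * A idx ≤ tOp A := by
  obtain ⟨C, hC⟩ := (isCompact_unitBallProduct n k).bddAbove_image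
    (continuous_tensorForm A).continuousOn
  refine le_ciSup (f := fun v : {v : Fin k → Fin n → ℝ // ∀ j, ∑ i, (v j i) ^ 2 ≤ 1} =>
    ∑ idx : Fin k → Fin n, (∏ j, v.1 j (idx j)) * A idx) ⟨C, ?_⟩ ⟨v, hv⟩
  rintro _ ⟨w, rfl⟩
  exact hC ⟨w.1, w.2, rfl⟩

/-- The operator norm of a nonnegative tensor is attained at nonnegative vectors. -/
theorem exists_nonneg_tOp_le {n k : ℕ} {A : (Fin k → Fin n) → ℝ} (hA : ∀ idx, 0 ≤ A idx) :
    ∃ v : Fin k → Fin n → ℝ, (∀ j i, 0 ≤ v j i) ∧ (∀ j, ∑ i, (v j i) ^ 2 ≤ 1) ∧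
      tOp A ≤ ∑ idx : Fin k → Fin n, (∏ j, v j (idx j)) * A idx := by
  have h0 : (0 : Fin k → Fin n → ℝ) ∈ {v : Fin k → Fin n → ℝ | ∀ j, ∑ i, (v j i) ^ 2 ≤ 1} := by
    intro j
    simp
  obtain ⟨v, hv, hmax⟩ := (isCompact_unitBallProduct n k).exists_isMaxOn ⟨0, h0⟩
    (continuous_tensorForm A).continuousOn
  refine ⟨fun j i => |v j i|, fun j i => abs_nonneg _, fun j => ?_, ?_⟩
  · simpa only [sq_abs] using hv j
  · have : Nonempty {v : Fin k → Fin n → ℝ // ∀ j, ∑ i, (v j i) ^ 2 ≤ 1} := ⟨⟨0, h0⟩⟩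
    refine (ciSup_le fun w => hmax w.2).trans (sum_le_sum fun idx _ => ?_)
    rw [← Finset.abs_prod]
    exact mul_le_mul_of_nonneg_right (le_abs_self _) (hA idx)

section Difference

variable {n : ℕ} {𝒳 : Fin n → Type*}

/-- The iterated difference whose absolute value is maximized in `hOrd`. -/
def iterDiff (f : (∀ i, 𝒳 i) → ℝ) (k : ℕ) (idx : Fin k → Fin n) (x y z : ∀ i, 𝒳 i) : ℝ :=
  ∑ S ∈ (Finset.univ : Finset (Fin k)).powerset, (-1 : ℝ) ^ S.card *
    f (fun i => if i ∈ Finset.image idx S then z i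
                else if i ∈ Finset.image idx Finset.univ then y i else x i)

theorem hOrd_nonneg (f : (∀ i, 𝒳 i) → ℝ) (k : ℕ) (idx : Fin k → Fin n) (x : ∀ i, 𝒳 i) :
    0 ≤ hOrd f k idx x :=
  Real.iSup_nonneg fun _ => abs_nonneg _

theorem hT_nonneg (f : (∀ i, 𝒳 i) → ℝ) (k : ℕ) (idx : Fin k → Fin n) (x : ∀ i, 𝒳 i) :
    0 ≤ hT f k idx x := by
  unfold hT
  split_ifs
  exacts [hOrd_nonneg f k idx x, le_rfl]

theorem abs_iterDiff_le_hOrd {f : (∀ i, 𝒳 i) → ℝ} (hbd : ∃ M, ∀ x, |f x| ≤ M) (k : ℕ)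
    (idx : Fin k → Fin n) (x y z : ∀ i, 𝒳 i) :
    |iterDiff f k idx x y z| ≤ hOrd f k idx x := by
  obtain ⟨M, hM⟩ := hbd
  refine le_ciSup (f := fun y : (∀ i, 𝒳 i) × (∀ i, 𝒳 i) => |iterDiff f k idx x y.1 y.2|)
    ⟨∑ _S ∈ (Finset.univ : Finset (Fin k)).powerset, M, ?_⟩ (y, z)
  rintro _ ⟨w, rfl⟩
  refine (abs_sum_le_sum_abs _ _).trans (sum_le_sum fun S _ => ?_)
  rw [abs_mul, abs_pow, abs_neg, abs_one, one_pow, one_mul]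
  exact hM _

theorem iterDiff_update_of_mem (f : (∀ i, 𝒳 i) → ℝ) (k : ℕ) (idx : Fin k → Fin n)
    (x y z : ∀ i, 𝒳 i) {i : Fin n} (hi : i ∈ Set.range idx) (a : 𝒳 i) :
    iterDiff f k idx (Function.update x i a) y z = iterDiff f k idx x y z := by
  unfold iterDiff
  refine sum_congr rfl fun S _ => ?_
  congr 2
  funext l
  split_ifs with h1 h2
  · rfl
  · rfl
  · refine Function.update_of_ne ?_ _ _
    rintro rfl
    exact h2 (by simpa using hi)

/-- The iterated difference along `i, idx` is the difference of iterated differences. -/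
theorem iterDiff_cons (f : (∀ i, 𝒳 i) → ℝ) (k : ℕ) (idx : Fin k → Fin n)
    (x y z : ∀ i, 𝒳 i) {i : Fin n} (hi : i ∉ Set.range idx) (a : 𝒳 i) :
    iterDiff f (k + 1) (Fin.cons i idx) x (Function.update y i (x i)) (Function.update z i a) =
      iterDiff f k idx x y z - iterDiff f k idx (Function.update x i a) y z := by
  have hi' : ∀ l, idx l ≠ i := fun l hl => hi ⟨l, hl⟩
  unfold iterDiff
  rw [Fin.univ_succ, cons_eq_insert, sum_powerset_insert (by simp), sub_eq_add_neg,
    ← sum_neg_distrib]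
  have hpow : (Finset.univ.map ⟨Fin.succ, Fin.succ_injective k⟩).powerset =
      (Finset.univ : Finset (Fin k)).powerset.map
        (mapEmbedding ⟨Fin.succ, Fin.succ_injective k⟩).toEmbedding := by
    ext S
    simp only [mem_powerset, Finset.mem_map, subset_map_iff]
    constructor
    · rintro ⟨u, hu, rfl⟩
      exact ⟨u, hu, rfl⟩
    · rintro ⟨u, hu, rfl⟩
      exact ⟨u, hu, rfl⟩
  rw [hpow, sum_map, sum_map]
  have himg : ∀ S : Finset (Fin k),
      Finset.image (Fin.cons i idx : Fin (k + 1) → Fin n)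
        (S.map ⟨Fin.succ, Fin.succ_injective k⟩) = Finset.image idx S := by
    intro S
    ext l
    simp
  congr 1
  · refine sum_congr rfl fun S _ => ?_
    simp only [RelEmbedding.coe_toEmbedding, mapEmbedding_apply, card_map, himg, image_insert,
      Fin.cons_zero]
    congr 2
    funext l
    rcases eq_or_ne l i with rfl | hl
    · simp [hi']
    · simp [hl]
  · refine sum_congr rfl fun S _ => ?_
    simp only [RelEmbedding.coe_toEmbedding, mapEmbedding_apply, himg, image_insert,
      Fin.cons_zero]
    rw [card_insert_of_notMem (by simp), card_map, pow_succ, mul_neg_one, neg_mul]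
    congr 3
    funext l
    rcases eq_or_ne l i with rfl | hl
    · simp [hi']
    · simp [hl]

theorem hT_le_hT_update_add {f : (∀ i, 𝒳 i) → ℝ} (hbd : ∃ M, ∀ x, |f x| ≤ M) (k : ℕ)
    (idx : Fin k → Fin n) (x : ∀ i, 𝒳 i) (i : Fin n) (a : 𝒳 i) :
    hT f k idx x ≤ hT f k idx (Function.update x i a) + hT f (k + 1) (Fin.cons i idx) x := by
  by_cases hidx : Function.Injective idx
  · have : Nonempty ((∀ i, 𝒳 i) × (∀ i, 𝒳 i)) := ⟨(x, x)⟩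
    simp only [hT, hidx, if_true, Fin.cons_injective_iff, and_true]
    refine ciSup_le fun w => ?_
    change |iterDiff f k idx x w.1 w.2| ≤ _
    by_cases hi : i ∈ Set.range idx
    · rw [← iterDiff_update_of_mem f k idx x w.1 w.2 hi a]
      simpa [hi] using abs_iterDiff_le_hOrd hbd k idx (Function.update x i a) w.1 w.2
    · rw [if_pos hi]
      have h1 := abs_iterDiff_le_hOrd hbd k idx (Function.update x i a) w.1 w.2
      have h2 := abs_iterDiff_le_hOrd hbd (k + 1) (Fin.cons i idx) x
        (Function.update w.1 i (x i)) (Function.update w.2 i a)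
      rw [iterDiff_cons f k idx x w.1 w.2 hi a] at h2
      have h3 := abs_sub_abs_le_abs_sub (iterDiff f k idx x w.1 w.2)
        (iterDiff f k idx (Function.update x i a) w.1 w.2)
      linarith
  · have h0 : hT f k idx x = 0 := if_neg hidx
    rw [h0]
    exact add_nonneg (hT_nonneg _ _ _ _) (hT_nonneg _ _ _ _)

end Difference

/-- Contracting a tensor in its last arguments yields a vector of norm at most `tOp`. -/
theorem sqrt_sum_contract_sq_le_tOp {n k : ℕ} (A : (Fin (k + 1) → Fin n) → ℝ)
    (v : Fin k → Fin n → ℝ) (hv : ∀ j, ∑ i, (v j i) ^ 2 ≤ 1) :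
    Real.sqrt (∑ i, (∑ idx : Fin k → Fin n, (∏ j, v j (idx j)) * A (Fin.cons i idx)) ^ 2) ≤
      tOp A := by
  set g : Fin n → ℝ := fun i =>
    ∑ idx : Fin k → Fin n, (∏ j, v j (idx j)) * A (Fin.cons i idx) with hg
  set s : ℝ := Real.sqrt (∑ i, (g i) ^ 2) with hs
  have hss : ∑ i, (g i) ^ 2 = s ^ 2 := (Real.sq_sqrt (sum_nonneg fun i _ => sq_nonneg _)).symm
  have key := le_tOp A (Fin.cons (fun i => g i / s) v : Fin (k + 1) → Fin n → ℝ) (by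
    refine Fin.cases ?_ fun j => ?_
    · simp only [Fin.cons_zero, div_pow]
      rw [← sum_div, hss]
      exact div_self_le_one _
    · simpa only [Fin.cons_succ] using hv j)
  refine le_trans (le_of_eq ?_) key
  rw [← (Fin.consEquiv fun _ : Fin (k + 1) => Fin n).sum_comp, Fintype.sum_prod_type]
  simp only [Fin.consEquiv_apply, Fin.prod_univ_succ, Fin.cons_zero, Fin.cons_succ, mul_assoc,
    ← mul_sum]
  calc s = s ^ 2 / s := by rw [sq, mul_self_div_self]
    _ = ∑ i, g i / s * g i := by
      rw [← hss, sum_div]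
      exact sum_congr rfl fun i _ => by ring

/-- the recursive estimate `|𝔥⁺|𝔥^{(d-1)}f|_op| ≤ |𝔥^{(d)}f|_op`
(Lemma `lemma:recursiveEstimateOperatorNorms`). -/
theorem stmt13 {n : ℕ} {𝒳 : Fin n → Type*}
    (f : (∀ i, 𝒳 i) → ℝ) (hbd : ∃ M, ∀ x, |f x| ≤ M)
    (d : ℕ) (hd : 2 ≤ d) (x : ∀ i, 𝒳 i) :
    Real.sqrt (∑ i,
        (hPlusI (fun y => tOp (fun idx : Fin (d - 1) → Fin n => hT f (d - 1) idx y)) i x) ^ 2) ≤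
      tOp (fun idx : Fin d → Fin n => hT f d idx x) := by
  obtain ⟨k, rfl⟩ : ∃ k, d = k + 1 := ⟨d - 1, by omega⟩
  change Real.sqrt (∑ i,
    (hPlusI (fun y => tOp fun idx : Fin k → Fin n => hT f k idx y) i x) ^ 2) ≤ _
  obtain ⟨v, hv0, hv1, hv⟩ := exists_nonneg_tOp_le fun idx => hT_nonneg f k idx x
  refine le_trans (Real.sqrt_le_sqrt (sum_le_sum fun i _ => ?_))
    (sqrt_sum_contract_sq_le_tOp (fun idx => hT f (k + 1) idx x) v hv1)
  refine pow_le_pow_left₀ (Real.iSup_nonneg fun _ => le_max_right _ _) ?_ 2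
  have : Nonempty (𝒳 i) := ⟨x i⟩
  have hprod : ∀ idx : Fin k → Fin n, 0 ≤ ∏ j, v j (idx j) :=
    fun idx => prod_nonneg fun j _ => hv0 j _
  refine ciSup_le fun a => max_le ?_
    (sum_nonneg fun idx _ => mul_nonneg (hprod idx) (hT_nonneg _ _ _ _))
  have hle := le_tOp (fun idx => hT f k idx (Function.update x i a)) v hv1
  have hstep : ∑ idx : Fin k → Fin n, (∏ j, v j (idx j)) * hT f k idx x ≤
      ∑ idx : Fin k → Fin n, (∏ j, v j (idx j)) * hT f k idx (Function.update x i a) +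
        ∑ idx : Fin k → Fin n, (∏ j, v j (idx j)) * hT f (k + 1) (Fin.cons i idx) x := by
    rw [← sum_add_distrib]
    refine sum_le_sum fun idx _ => ?_
    rw [← mul_add]
    exact mul_le_mul_of_nonneg_left (hT_le_hT_update_add hbd k idx x i a) (hprod idx)
  linarith
end

section
/- Let f be a bounded random variable, s ∈ [0,2), and C_1,…,C_d ≥ 0 constants such that for all p ≥ 2, ‖f − 𝔼f‖_p ≤ Σ_{k=1}^d C_k (p − s)^{k/2}. Let L := |{ l : C_l > 0 }|. Then for all t ≥ 0, ℙ( |f − 𝔼f| ≥ t ) ≤ 2 exp( − min( log 2 / (2 − s), 1 ) · min_{k=1,…,d} ( t / (L e C_k) )^{2/k} ), where the minimum over k is taken over those k with C_k > 0. -/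
open MeasureTheory Finset Real Filter

/-- Markov's inequality in terms of `L^p` norms: a bound `‖g‖_p ≤ t / e` gives the tail `e^{-p}`. -/
theorem measure_le_exp_neg_of_lpN_le {α : Type*} [MeasurableSpace α] {μ : Measure α}
    [IsFiniteMeasure μ] {g : α → ℝ} (hg : Measurable g) {M : ℝ} (hM : ∀ x, |g x| ≤ M)
    {p t : ℝ} (hp : 0 < p) (ht : 0 < t) (h : lpN μ p g ≤ t / Real.exp 1) :
    μ {x | t ≤ |g x|} ≤ ENNReal.ofReal (Real.exp (-p)) := by
  have hint : Integrable (fun x => |g x| ^ p) μ := by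
    refine Integrable.of_bound (C := M ^ p)
      (by simpa using (hg.norm.pow_const p).aestronglyMeasurable) (ae_of_all _ fun x => ?_)
    rw [Real.norm_of_nonneg (by positivity)]
    exact Real.rpow_le_rpow (abs_nonneg _) (hM x) hp.le
  have hI : 0 ≤ ∫ x, |g x| ^ p ∂μ := integral_nonneg fun x => by positivity
  have hle : ∫ x, |g x| ^ p ∂μ ≤ t ^ p * Real.exp (-p) := by
    calc ∫ x, |g x| ^ p ∂μ = lpN μ p g ^ p := by
          rw [lpN, ← Real.rpow_mul hI, one_div, inv_mul_cancel₀ hp.ne', Real.rpow_one]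
      _ ≤ (t / Real.exp 1) ^ p :=
          Real.rpow_le_rpow (Real.rpow_nonneg hI _) h hp.le
      _ = t ^ p * Real.exp (-p) := by
          rw [Real.div_rpow ht.le (Real.exp_pos _).le, Real.exp_one_rpow, Real.exp_neg,
            div_eq_mul_inv]
  have hmarkov := mul_meas_ge_le_integral_of_nonneg (μ := μ)
    (ae_of_all _ fun x => by positivity) hint (t ^ p)
  have hset : {x | t ^ p ≤ |g x| ^ p} = {x | t ≤ |g x|} := by
    ext x
    exact Real.rpow_le_rpow_iff ht.le (abs_nonneg _) hp
  rw [hset] at hmarkov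
  rw [← ofReal_measureReal]
  exact ENNReal.ofReal_le_ofReal
    (le_of_mul_le_mul_left (hmarkov.trans hle) (Real.rpow_pos_of_pos ht p))

/-- Below the level `min_k (t / (|A| e C_k))^{2/k}`, a polynomial in `√N` is at most `t / e`. -/
theorem sum_mul_rpow_le_div_exp {A : Finset ℕ} (hA : A.Nonempty) {C : ℕ → ℝ}
    (hk : ∀ k ∈ A, k ≠ 0) (hC : ∀ k ∈ A, 0 < C k) {N t : ℝ} (hN : 0 ≤ N) (ht : 0 ≤ t)
    (h : ∀ k ∈ A, N ≤ (t / ((A.card : ℝ) * Real.exp 1 * C k)) ^ ((2 : ℝ) / k)) :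
    ∑ k ∈ A, C k * N ^ ((k : ℝ) / 2) ≤ t / Real.exp 1 := by
  have hL : (0 : ℝ) < A.card := by exact_mod_cast hA.card_pos
  have hterm : ∀ k ∈ A, C k * N ^ ((k : ℝ) / 2) ≤ t / ((A.card : ℝ) * Real.exp 1) := by
    intro k hkA
    have hk0 : (k : ℝ) ≠ 0 := by exact_mod_cast hk k hkA
    have hCk := hC k hkA
    have hbase : 0 ≤ t / ((A.card : ℝ) * Real.exp 1 * C k) := by positivity
    have hpow := Real.rpow_le_rpow hN (h k hkA) (by positivity : (0 : ℝ) ≤ (k : ℝ) / 2)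
    rw [← Real.rpow_mul hbase, div_mul_div_cancel₀ hk0, div_self two_ne_zero,
      Real.rpow_one] at hpow
    calc C k * N ^ ((k : ℝ) / 2) ≤ C k * (t / ((A.card : ℝ) * Real.exp 1 * C k)) := by gcongr
      _ = t / ((A.card : ℝ) * Real.exp 1) := by field_simp
  calc ∑ k ∈ A, C k * N ^ ((k : ℝ) / 2) ≤ ∑ _k ∈ A, t / ((A.card : ℝ) * Real.exp 1) :=
        Finset.sum_le_sum hterm
    _ = t / Real.exp 1 := by
        rw [Finset.sum_const, nsmul_eq_mul]
        field_simp

open scoped Classical in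
/-- from moment growth estimates to multilevel concentration inequalities
(Proposition `proposition:FromLpToCoM`). -/
theorem stmt14 {Ω : Type*} [MeasurableSpace Ω] (μ : Measure Ω) (hμ : IsProbabilityMeasure μ)
    (f : Ω → ℝ) (hf : Measurable f) (hbd : ∃ M, ∀ x, |f x| ≤ M)
    (s : ℝ) (hs0 : 0 ≤ s) (hs2 : s < 2)
    (d : ℕ) (Cc : ℕ → ℝ) (hCnn : ∀ k ∈ Finset.Icc 1 d, 0 ≤ Cc k)
    (hmom : ∀ p : ℝ, 2 ≤ p → lpN μ p (fun x => f x - ∫ y, f y ∂μ) ≤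
      ∑ k ∈ Finset.Icc 1 d, Cc k * (p - s) ^ ((k : ℝ) / 2))
    (hne : ((Finset.Icc 1 d).filter (fun k => 0 < Cc k)).Nonempty)
    (t : ℝ) (ht : 0 ≤ t) :
    μ {x | t ≤ |f x - ∫ y, f y ∂μ|} ≤
      ENNReal.ofReal (2 * Real.exp (-(min (Real.log 2 / (2 - s)) 1) *
        ((Finset.Icc 1 d).filter (fun k => 0 < Cc k)).inf' hne (fun k =>
          (t / ((((Finset.Icc 1 d).filter (fun k => 0 < Cc k)).card : ℝ) *
            Real.exp 1 * Cc k)) ^ ((2 : ℝ) / k)))) := by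
  obtain ⟨M, hM⟩ := hbd
  set A := (Finset.Icc 1 d).filter (fun k => 0 < Cc k) with hAdef
  set N := A.inf' hne (fun k =>
    (t / ((A.card : ℝ) * Real.exp 1 * Cc k)) ^ ((2 : ℝ) / k)) with hNdef
  have hAk : ∀ k ∈ A, k ≠ 0 := fun k hk => by
    have := (Finset.mem_Icc.mp (Finset.mem_filter.mp hk).1).1
    omega
  have hAC : ∀ k ∈ A, 0 < Cc k := fun k hk => (Finset.mem_filter.mp hk).2
  have hNle : ∀ k ∈ A, N ≤ (t / ((A.card : ℝ) * Real.exp 1 * Cc k)) ^ ((2 : ℝ) / k) :=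
    fun k hk => Finset.inf'_le _ hk
  have hN0 : 0 ≤ N := by
    refine Finset.le_inf' _ _ fun k hk => ?_
    have := hAC k hk
    positivity
  rcases lt_or_ge N (2 - s) with hlt | hge
  · refine prob_le_one.trans ?_
    rw [ENNReal.one_le_ofReal]
    have h2s : 0 < 2 - s := by linarith
    have hexp : min (Real.log 2 / (2 - s)) 1 * N ≤ Real.log 2 := by
      calc min (Real.log 2 / (2 - s)) 1 * N ≤ Real.log 2 / (2 - s) * (2 - s) := by
            gcongr
            exact min_le_left _ _
        _ = Real.log 2 := div_mul_cancel₀ _ h2s.ne'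
    calc (1 : ℝ) = 2 * Real.exp (-Real.log 2) := by
          rw [Real.exp_neg, Real.exp_log two_pos, mul_inv_cancel₀ two_ne_zero]
      _ ≤ 2 * Real.exp (-min (Real.log 2 / (2 - s)) 1 * N) := by
          gcongr
          linarith
  · have hNpos : 0 < N := by linarith
    have htpos : 0 < t := by
      refine ht.lt_of_ne' ?_
      rintro rfl
      obtain ⟨k, hk⟩ := hne
      have hk0 : (k : ℝ) ≠ 0 := by exact_mod_cast hAk k hk
      have := hNle k hk
      rw [zero_div, Real.zero_rpow (by positivity)] at this
      linarith
    have hsum : ∑ k ∈ Finset.Icc 1 d, Cc k * N ^ ((k : ℝ) / 2) =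
        ∑ k ∈ A, Cc k * N ^ ((k : ℝ) / 2) := by
      refine (Finset.sum_subset (Finset.filter_subset _ _) fun k hk hkA => ?_).symm
      have : Cc k = 0 := (hCnn k hk).eq_of_not_lt' fun h => hkA (Finset.mem_filter.mpr ⟨hk, h⟩)
      rw [this, zero_mul]
    have hlp := hmom (N + s) (by linarith)
    rw [add_sub_cancel_right, hsum] at hlp
    refine (measure_le_exp_neg_of_lpN_le (hf.sub_const _)
      (fun x => (abs_sub _ _).trans (add_le_add_left (hM x) _)) (by linarith) htpos
      (hlp.trans (sum_mul_rpow_le_div_exp hne hAk hAC hN0 ht hNle))).trans ?_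
    refine ENNReal.ofReal_le_ofReal ?_
    have hmin : min (Real.log 2 / (2 - s)) 1 * N ≤ 1 * N := by
      gcongr
      exact min_le_right _ _
    calc Real.exp (-(N + s)) ≤ Real.exp (-min (Real.log 2 / (2 - s)) 1 * N) := by
          gcongr
          linarith
      _ ≤ 2 * Real.exp (-min (Real.log 2 / (2 - s)) 1 * N) := by
          linarith [Real.exp_pos (-min (Real.log 2 / (2 - s)) 1 * N)]
end

section
/- Let (𝓑, ‖·‖) be a Banach space and 𝓕 a family of uniformly norm-bounded, 𝓑-valued, measurable functions on 𝒴 = 𝒳_1 × ⋯ × 𝒳_n, and set g(X) = sup_{f ∈ 𝓕} ‖f(X)‖. Then pointwise, |𝔥⁺ g(X)| ≤ sup_{f ∈ 𝓕} | 𝔥⁺ ‖f‖ (X) |, where ‖f‖ denotes the real-valued function x ↦ ‖f(x)‖. -/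
open MeasureTheory Finset Real Filter

lemma hPlusI_nonneg {n : ℕ} {𝒳 : Fin n → Type*} (f : (∀ i, 𝒳 i) → ℝ) (i : Fin n)
    (x : ∀ j, 𝒳 j) : 0 ≤ hPlusI f i x :=
  Real.iSup_nonneg fun _ => le_max_right _ _

lemma hPlusI_le_of_nonneg {n : ℕ} {𝒳 : Fin n → Type*} {f : (∀ i, 𝒳 i) → ℝ}
    (hf : ∀ y, 0 ≤ f y) (i : Fin n) (x : ∀ j, 𝒳 j) : hPlusI f i x ≤ f x :=
  Real.iSup_le (fun y => max_le (by linarith [hf (Function.update x i y)]) (hf x)) (hf x)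

lemma le_hPlusI {n : ℕ} {𝒳 : Fin n → Type*} {f : (∀ i, 𝒳 i) → ℝ}
    (hf : ∀ y, 0 ≤ f y) (i : Fin n) (x : ∀ j, 𝒳 j) (y : 𝒳 i) :
    f x - f (Function.update x i y) ≤ hPlusI f i x := by
  have hbdd : BddAbove (Set.range fun y : 𝒳 i => max (f x - f (Function.update x i y)) 0) := by
    refine ⟨f x, ?_⟩
    rintro _ ⟨z, rfl⟩
    exact max_le (by linarith [hf (Function.update x i z)]) (hf x)
  exact (le_max_left _ _).trans (le_ciSup hbdd y)

/-- If `f ≤ g` and `f` nearly attains `g` at `x`, then `𝔥⁺_i g` is nearly bounded by `𝔥⁺_i f`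
at `x`. -/
lemma hPlusI_le_hPlusI_add {n : ℕ} {𝒳 : Fin n → Type*} {f g : (∀ i, 𝒳 i) → ℝ} {ε : ℝ}
    (hf : ∀ y, 0 ≤ f y) (hfg : ∀ y, f y ≤ g y) (i : Fin n) (x : ∀ j, 𝒳 j) (hε : 0 ≤ ε)
    (hx : g x ≤ f x + ε) : hPlusI g i x ≤ hPlusI f i x + ε := by
  have h0 := hPlusI_nonneg f i x
  refine Real.iSup_le (fun y => max_le ?_ (by positivity)) (by positivity)
  linarith [le_hPlusI hf i x y, hfg (Function.update x i y)]

/-- `|𝔥⁺ g| ≤ sup_{f ∈ 𝓕} |𝔥⁺‖f‖|` for `g = sup_{f ∈ 𝓕} ‖f‖`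
(Lemma `lemma:hPlusEstimateSupremum`). -/
theorem stmt16 {n : ℕ} {𝒳 : Fin n → Type*} [∀ i, MeasurableSpace (𝒳 i)]
    {B : Type*} [NormedAddCommGroup B] {ι : Type*} [Nonempty ι]
    (F : ι → (∀ i, 𝒳 i) → B) (hmeas : ∀ j, Measurable (fun y => ‖F j y‖))
    (hbd : ∃ M, ∀ j x, ‖F j x‖ ≤ M) (x : ∀ i, 𝒳 i) :
    Real.sqrt (∑ i, (hPlusI (fun y => ⨆ j, ‖F j y‖) i x) ^ 2) ≤
      ⨆ j, Real.sqrt (∑ i, (hPlusI (fun y => ‖F j y‖) i x) ^ 2) := by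
  obtain ⟨M, hM⟩ := hbd
  have hbddF : ∀ y, BddAbove (Set.range fun j => ‖F j y‖) := fun y =>
    ⟨M, by rintro _ ⟨j, rfl⟩; exact hM j y⟩
  have hbdd : BddAbove (Set.range fun j =>
      Real.sqrt (∑ i, (hPlusI (fun y => ‖F j y‖) i x) ^ 2)) := by
    refine ⟨Real.sqrt (∑ _i : Fin n, M ^ 2), ?_⟩
    rintro _ ⟨j, rfl⟩
    refine Real.sqrt_le_sqrt (Finset.sum_le_sum fun i _ => ?_)
    exact pow_le_pow_left₀ (hPlusI_nonneg _ i x)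
      ((hPlusI_le_of_nonneg (fun y => norm_nonneg (F j y)) i x).trans (hM j x)) 2
  set a : Fin n → ℝ := fun i => hPlusI (fun y => ⨆ j, ‖F j y‖) i x
  have hlim : Tendsto (fun ε : ℝ => Real.sqrt (∑ i, (max (a i - ε) 0) ^ 2))
      (nhdsWithin 0 (Set.Ioi 0)) (nhds (Real.sqrt (∑ i, (a i) ^ 2))) := by
    have hcont : Continuous fun ε : ℝ => Real.sqrt (∑ i, (max (a i - ε) 0) ^ 2) := by fun_prop
    have h0 : ∀ i, max (a i - 0) 0 = a i := fun i => by
      rw [sub_zero, max_eq_left (hPlusI_nonneg _ i x)]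
    simpa only [h0] using (hcont.tendsto 0).mono_left nhdsWithin_le_nhds
  refine le_of_tendsto hlim (eventually_nhdsWithin_of_forall fun ε (hε : 0 < ε) => ?_)
  obtain ⟨j, hj⟩ := exists_lt_of_lt_ciSup (sub_lt_self (⨆ j, ‖F j x‖) hε)
  refine le_trans ?_ (le_ciSup hbdd j)
  refine Real.sqrt_le_sqrt (Finset.sum_le_sum fun i _ => ?_)
  have hi : a i ≤ hPlusI (fun y => ‖F j y‖) i x + ε :=
    hPlusI_le_hPlusI_add (fun y => norm_nonneg (F j y)) (fun y => le_ciSup (hbddF y) j) i x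
      hε.le (by linarith)
  exact pow_le_pow_left₀ (le_max_right _ _)
    (max_le (by linarith) (hPlusI_nonneg _ i x)) 2
end

section
/- Let 𝒴 = 𝒳_1 × ⋯ × 𝒳_n be a product of Polish spaces with product Borel σ-algebra 𝒜, and let μ be a probability measure on 𝒴. (i) If μ satisfies a 𝔡-LSI(σ²) for some σ² > 0, then μ has finite support, i.e. there is no sequence of sets A_m ∈ 𝒜 with μ(A_m) > 0 for all m and μ(A_m) → 0. (ii) If μ is a product probability measure, then μ satisfies a 𝔡-LSI(σ²) for some σ² > 0 if and only if μ has finite support. -/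
open MeasureTheory Finset Real Filter

/-- `μ` has finite support in the sense of the paper: there is no sequence of sets of
positive measure whose measures tend to `0`. -/
def FinSupport {α : Type*} [MeasurableSpace α] (μ : MeasureTheory.Measure α) : Prop :=
  ¬∃ A : ℕ → Set α, (∀ m, MeasurableSet (A m)) ∧ (∀ m, 0 < μ (A m)) ∧
    Filter.Tendsto (fun m => μ (A m)) Filter.atTop (nhds 0)

section

open MeasureTheory

theorem abs_sq_le_of_bounded {α : Type*} {g : α → ℝ} (hb : ∃ M, ∀ x, |g x| ≤ M) :
    ∃ M, ∀ x, |g x ^ 2| ≤ M := by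
  obtain ⟨M, hM⟩ := hb
  exact ⟨M ^ 2, fun x => by rw [abs_pow]; gcongr; exact hM x⟩

theorem abs_sub_le_of_bounded {α : Type*} {f g : α → ℝ} (hf : ∃ M, ∀ x, |f x| ≤ M)
    (hg : ∃ M, ∀ x, |g x| ≤ M) : ∃ M, ∀ x, |f x - g x| ≤ M := by
  obtain ⟨M, hM⟩ := hf
  obtain ⟨N, hN⟩ := hg
  exact ⟨M + N, fun x => (abs_sub _ _).trans (add_le_add (hM x) (hN x))⟩

variable {α : Type*} [MeasurableSpace α] {μ : Measure α}

theorem integrable_of_measurable_of_abs_le [IsFiniteMeasure μ] {g : α → ℝ} (hg : Measurable g)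
    (hb : ∃ M, ∀ x, |g x| ≤ M) : Integrable g μ := by
  obtain ⟨M, hM⟩ := hb
  exact Integrable.of_bound hg.aestronglyMeasurable M (Filter.Eventually.of_forall hM)

/-- The squared mean is at most the mean square. -/
theorem sq_integral_le_integral_sq [IsProbabilityMeasure μ] {g : α → ℝ}
    (hg : Integrable g μ) (hg2 : Integrable (fun x => g x ^ 2) μ) :
    (∫ x, g x ∂μ) ^ 2 ≤ ∫ x, g x ^ 2 ∂μ := by
  set m := ∫ x, g x ∂μ with hm
  have h : 0 ≤ ∫ x, (g x - m) ^ 2 ∂μ := integral_nonneg fun x => sq_nonneg _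
  have e : ∫ x, (g x - m) ^ 2 ∂μ = ∫ x, g x ^ 2 ∂μ - m ^ 2 := by
    calc ∫ x, (g x - m) ^ 2 ∂μ = ∫ x, (g x ^ 2 - 2 * m * g x) + m ^ 2 ∂μ := by
          congr 1; ext x; ring
      _ = ∫ x, g x ^ 2 ∂μ - m ^ 2 := by
          have il : Integrable (fun x => 2 * m * g x) μ := hg.const_mul _
          have is : Integrable (fun x => g x ^ 2 - 2 * m * g x) μ := hg2.sub il
          rw [integral_add is (integrable_const _), integral_sub hg2 il, integral_const_mul, ← hm]
          simp
          ring
  linarith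

/-- A finitely supported measure charges no measurable set arbitrarily little. -/
theorem FinSupport.exists_le_measureReal [IsProbabilityMeasure μ] (h : FinSupport μ) :
    ∃ c : ℝ, 0 < c ∧ ∀ A, MeasurableSet A → 0 < μ A → c ≤ μ.real A := by
  by_contra! H
  refine h ?_
  choose A hA hpos hlt using fun m : ℕ => H (1 / ((m : ℝ) + 1)) Nat.one_div_pos_of_nat
  refine ⟨A, hA, hpos, ?_⟩
  rw [← ENNReal.tendsto_toReal_iff (fun m => measure_ne_top _ _) ENNReal.zero_ne_top]
  exact squeeze_zero (fun m => ENNReal.toReal_nonneg) (fun m => (hlt m).le)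
    tendsto_one_div_add_atTop_nhds_zero_nat

/-- The entropy of a bounded nonnegative function is at most its `χ²`-type functional. -/
theorem ent_le_integral_sq_div [IsProbabilityMeasure μ] {g : α → ℝ} (hg : Measurable g)
    (h0 : ∀ x, 0 ≤ g x) (hb : ∃ M, ∀ x, |g x| ≤ M) (ht : 0 < ∫ x, g x ∂μ) :
    ent μ g ≤ (∫ x, (g x - ∫ y, g y ∂μ) ^ 2 ∂μ) / ∫ x, g x ∂μ := by
  set t := ∫ x, g x ∂μ with htdef
  have ig : Integrable g μ := integrable_of_measurable_of_abs_le hg hb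
  have i2 : Integrable (fun x => (g x - t) ^ 2) μ :=
    integrable_of_measurable_of_abs_le ((hg.sub_const _).pow_const 2)
      (abs_sq_le_of_bounded (abs_sub_le_of_bounded hb ⟨|t|, fun _ => le_rfl⟩))
  have ilog : Integrable (fun x => g x * Real.log (g x)) μ := by
    obtain ⟨M, hM⟩ := hb
    obtain ⟨K, hK⟩ := (isCompact_Icc (a := (0 : ℝ)) (b := M)).exists_bound_of_continuousOn
      Real.continuous_mul_log.continuousOn
    exact integrable_of_measurable_of_abs_le (hg.mul (Real.measurable_log.comp hg))
      ⟨K, fun x => hK (g x) ⟨h0 x, (le_abs_self _).trans (hM x)⟩⟩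
  have key : ∀ x, g x * Real.log (g x) ≤ g x * Real.log t + ((g x - t) ^ 2 / t + (g x - t)) := by
    intro x
    have e : (g x - t) ^ 2 / t + (g x - t) = g x * (g x / t - 1) := by field_simp; ring
    rw [e]
    rcases (h0 x).eq_or_lt with hx | hx
    · simp [← hx]
    · have h1 := Real.log_le_sub_one_of_pos (div_pos hx ht)
      rw [Real.log_div hx.ne' ht.ne'] at h1
      nlinarith
  have hint : ∫ x, g x * Real.log (g x) ∂μ ≤
      ∫ x, g x * Real.log t + ((g x - t) ^ 2 / t + (g x - t)) ∂μ :=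
    integral_mono ilog ((ig.mul_const _).add ((i2.div_const _).add (ig.sub (integrable_const _))))
      key
  have isub : Integrable (fun x => g x - t) μ := ig.sub (integrable_const _)
  have iadd : Integrable (fun x => (g x - t) ^ 2 / t + (g x - t)) μ := (i2.div_const _).add isub
  rw [integral_add (ig.mul_const _) iadd,
    integral_add (i2.div_const _) isub,
    integral_sub ig (integrable_const _), integral_mul_const, integral_div, ← htdef] at hint
  simp at hint
  simp only [ent, ← htdef]
  linarith

theorem integral_sq_sub_integral_sq_le [IsProbabilityMeasure μ] {g : α → ℝ} (hg : Measurable g)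
    (hb : ∃ M, ∀ x, |g x| ≤ M) (a : ℝ) :
    ∫ x, (g x - ∫ y, g y ∂μ) ^ 2 ∂μ ≤ ∫ x, (g x - a) ^ 2 ∂μ := by
  set t := ∫ x, g x ∂μ with htdef
  have ig : Integrable g μ := integrable_of_measurable_of_abs_le hg hb
  have i2 : Integrable (fun x => (g x - t) ^ 2) μ :=
    integrable_of_measurable_of_abs_le ((hg.sub_const _).pow_const 2)
      (abs_sq_le_of_bounded (abs_sub_le_of_bounded hb ⟨|t|, fun _ => le_rfl⟩))
  have ilin : Integrable (fun x => 2 * (t - a) * (g x - t)) μ :=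
    (ig.sub (integrable_const _)).const_mul _
  have e : ∫ x, (g x - a) ^ 2 ∂μ = ∫ x, (g x - t) ^ 2 ∂μ + (t - a) ^ 2 := by
    calc ∫ x, (g x - a) ^ 2 ∂μ
        = ∫ x, ((g x - t) ^ 2 + 2 * (t - a) * (g x - t)) + (t - a) ^ 2 ∂μ := by
          congr 1; ext x; ring
      _ = ∫ x, (g x - t) ^ 2 ∂μ + (t - a) ^ 2 := by
          have iadd : Integrable (fun x => (g x - t) ^ 2 + 2 * (t - a) * (g x - t)) μ := i2.add ilin
          rw [integral_add iadd (integrable_const _), integral_add i2 ilin,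
            integral_const_mul, integral_sub ig (integrable_const _), ← htdef]
          simp
  rw [e]
  linarith [sq_nonneg (t - a)]

/-- For a finitely supported measure, the entropy of `f²` is controlled by the variance of `f`. -/
theorem FinSupport.exists_ent_sq_le [IsProbabilityMeasure μ] (h : FinSupport μ) :
    ∃ K : ℝ, 0 < K ∧ ∀ f : α → ℝ, Measurable f → (∃ M, ∀ x, |f x| ≤ M) → ∀ a : ℝ,
      ent μ (fun x => f x ^ 2) ≤ K * ∫ x, (f x - a) ^ 2 ∂μ := by
  obtain ⟨c, hc, hA⟩ := h.exists_le_measureReal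
  refine ⟨4 / c + 2, by positivity, fun f hf hb a => ?_⟩
  have hb2 := abs_sq_le_of_bounded hb
  have hf2 : Measurable fun x => f x ^ 2 := hf.pow_const 2
  have i1 : Integrable f μ := integrable_of_measurable_of_abs_le hf hb
  have i2 : Integrable (fun x => f x ^ 2) μ := integrable_of_measurable_of_abs_le hf2 hb2
  have hmt := sq_integral_le_integral_sq i1 i2
  have hva := integral_sq_sub_integral_sq_le (μ := μ) hf hb a
  have ht0 : 0 ≤ ∫ x, f x ^ 2 ∂μ := integral_nonneg fun x => sq_nonneg _
  have hK : 0 < 4 / c + 2 := by positivity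
  refine le_trans ?_ (mul_le_mul_of_nonneg_left hva hK.le)
  set m := ∫ x, f x ∂μ with hm
  rcases ht0.eq_or_lt with ht | ht
  · have hz : (fun x => f x ^ 2) =ᵐ[μ] 0 :=
      (integral_eq_zero_iff_of_nonneg (fun x => sq_nonneg _) i2).1 ht.symm
    have he : ent μ (fun x => f x ^ 2) = 0 := by
      have : ∫ x, f x ^ 2 * Real.log (f x ^ 2) ∂μ = 0 :=
        integral_eq_zero_of_ae (hz.mono fun x hx => by
          have hx : f x ^ 2 = 0 := hx
          simp [hx])
      simp only [ent, this, ← ht]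
      simp
    rw [he]
    exact mul_nonneg hK.le (integral_nonneg fun x => sq_nonneg _)
  · refine (ent_le_integral_sq_div hf2 (fun x => sq_nonneg _) hb2 ht).trans ?_
    rw [div_le_iff₀ ht]
    refine (integral_sq_sub_integral_sq_le hf2 hb2 (m ^ 2)).trans ?_
    set t := ∫ x, f x ^ 2 ∂μ with htdef
    have hae : ∀ᵐ x ∂μ, f x ^ 2 < 2 * t / c := by
      have hmeas : MeasurableSet {x | 2 * t / c ≤ f x ^ 2} := measurableSet_le measurable_const hf2
      have hmark := mul_meas_ge_le_integral_of_nonneg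
        (Filter.Eventually.of_forall fun x => sq_nonneg (f x)) i2 (2 * t / c)
      have hzero : μ {x | 2 * t / c ≤ f x ^ 2} = 0 := by
        by_contra hne
        have h1 := hA _ hmeas (pos_iff_ne_zero.2 hne)
        have h2 : 2 * t / c * c ≤ t := (mul_le_mul_of_nonneg_left h1 (by positivity)).trans hmark
        rw [div_mul_cancel₀ _ hc.ne'] at h2
        linarith
      filter_upwards [measure_eq_zero_iff_ae_notMem.1 hzero] with x hx
      exact not_le.1 hx
    have iv : Integrable (fun x => (f x - m) ^ 2) μ :=
      integrable_of_measurable_of_abs_le ((hf.sub_const _).pow_const 2)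
        (abs_sq_le_of_bounded (abs_sub_le_of_bounded hb ⟨|m|, fun _ => le_rfl⟩))
    have : (4 / c + 2) * (∫ x, (f x - m) ^ 2 ∂μ) * t =
        ∫ x, (4 / c + 2) * t * (f x - m) ^ 2 ∂μ := by
      rw [integral_const_mul]; ring
    rw [this]
    refine integral_mono_of_nonneg (Filter.Eventually.of_forall fun x => sq_nonneg _)
      (iv.const_mul _) ?_
    filter_upwards [hae] with x hx
    have e1 : (f x ^ 2 - m ^ 2) ^ 2 = (f x + m) ^ 2 * (f x - m) ^ 2 := by ring
    have e2 : (4 / c + 2) * t = 2 * (2 * t / c) + 2 * t := by ring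
    rw [e1, e2]
    gcongr
    nlinarith [sq_nonneg (f x - m)]

end

section

open MeasureTheory

variable {n : ℕ} {𝒳 : Fin n → Type*} [∀ i, MeasurableSpace (𝒳 i)]

theorem measurable_comp_update {f : (∀ i, 𝒳 i) → ℝ} (hf : Measurable f) (i : Fin n)
    (x : ∀ i, 𝒳 i) : Measurable fun y => f (Function.update x i y) :=
  hf.comp (measurable_update x)

/-- The conditional means of a bounded measurable function are integrable. -/
theorem IsCondKernel.integrable {μ : Measure (∀ i, 𝒳 i)} [IsProbabilityMeasure μ]
    {ν : ∀ i, (∀ j, 𝒳 j) → Measure (𝒳 i)} (h : IsCondKernel μ ν) (i : Fin n)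
    {g : (∀ j, 𝒳 j) → ℝ} (hg : Measurable g) (hb : ∃ M, ∀ x, |g x| ≤ M) :
    Integrable (fun x => ∫ y, g (Function.update x i y) ∂(ν i x)) μ := by
  by_contra hn
  obtain ⟨M, hM⟩ := hb
  have e : (fun x => ∫ y, (g (Function.update x i y) + 1) ∂(ν i x)) =
      fun x => (∫ y, g (Function.update x i y) ∂(ν i x)) + 1 := by
    ext x
    have := h.1 i x
    rw [integral_add (integrable_of_measurable_of_abs_le (measurable_comp_update hg i x)
      ⟨M, fun y => hM _⟩) (integrable_const _)]
    simp
  have h0 := h.2.2 i g hg ⟨M, hM⟩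
  have h1 := h.2.2 i (fun x => g x + 1) (hg.add_const 1)
    ⟨M + 1, fun x => (abs_add_le _ _).trans (by simpa using hM x)⟩
  have hn' : ¬ Integrable (fun x => (∫ y, g (Function.update x i y) ∂(ν i x)) + 1) μ :=
    fun H => hn ((H.sub (integrable_const 1)).congr (Filter.Eventually.of_forall fun x => by simp))
  rw [e, integral_undef hn', integral_add (integrable_of_measurable_of_abs_le hg ⟨M, hM⟩)
    (integrable_const _), ← h0, integral_undef hn] at h1
  simp at h1

theorem DLSI.finSupport {μ : Measure (∀ i, 𝒳 i)} [IsProbabilityMeasure μ]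
    {ν : ∀ i, (∀ j, 𝒳 j) → Measure (𝒳 i)} {σ2 : ℝ} (h : DLSI μ ν σ2) (hσ : 0 < σ2) :
    FinSupport μ := by
  obtain ⟨hk, h⟩ := h
  have key : ∀ A : Set (∀ i, 𝒳 i), MeasurableSet A → 0 < μ A →
      Real.exp (-(2 * σ2 * n)) ≤ μ.real A := by
    intro A hA hpos
    have hp : 0 < μ.real A := ENNReal.toReal_pos hpos.ne' (measure_ne_top _ _)
    set f : (∀ i, 𝒳 i) → ℝ := A.indicator 1 with hf
    have hfm : Measurable f := measurable_one.indicator hA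
    have hf01 : ∀ x, f x = 0 ∨ f x = 1 := fun x => by
      by_cases hx : x ∈ A <;> simp [hf, hx]
    have hsq : ∀ x, f x ^ 2 = f x := fun x => by rcases hf01 x with hx | hx <;> simp [hx]
    have hfb : ∃ M, ∀ x, |f x| ≤ M := ⟨1, fun x => by rcases hf01 x with hx | hx <;> simp [hx]⟩
    have hint : ∫ x, f x ∂μ = μ.real A := integral_indicator_one hA
    have hlog : ∀ x, f x * Real.log (f x) = 0 := fun x => by
      rcases hf01 x with hx | hx <;> simp [hx]
    have hent : ent μ (fun x => f x ^ 2) = -(μ.real A * Real.log (μ.real A)) := by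
      simp [ent, hsq, hlog, hint]
    have hd : ∫ x, dSq ν f x ∂μ ≤ n * μ.real A := by
      have hi := fun i => hk.integrable i hfm hfb
      have hle : ∫ x, dSq ν f x ∂μ ≤
          ∫ x, ∑ i, ∫ y, f (Function.update x i y) ∂(ν i x) ∂μ := by
        refine integral_mono_of_nonneg
          (Filter.Eventually.of_forall fun x => Finset.sum_nonneg fun i _ =>
            integral_nonneg fun y => sq_nonneg _)
          (integrable_finsetSum _ fun i _ => hi i)
          (Filter.Eventually.of_forall fun x => Finset.sum_le_sum fun i _ => ?_)
        have := hk.1 i x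
        have hb' : ∃ M, ∀ y, |f (Function.update x i y)| ≤ M :=
          hfb.imp fun M hM y => hM _
        have := integral_sq_sub_integral_sq_le (μ := ν i x) (measurable_comp_update hfm i x) hb' 0
        simpa [hsq, cVar] using this
      rw [integral_finsetSum _ fun i _ => hi i] at hle
      simpa [hk.2.2 _ f hfm hfb, hint] using hle
    have hmain := h f hfm hfb
    rw [hent] at hmain
    have h1 : -(μ.real A * Real.log (μ.real A)) ≤ 2 * σ2 * (n * μ.real A) :=
      hmain.trans (mul_le_mul_of_nonneg_left hd (by positivity))
    rw [← Real.le_log_iff_exp_le hp]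
    have h2 : μ.real A * (-(2 * σ2 * n)) ≤ μ.real A * Real.log (μ.real A) := by linarith
    exact le_of_mul_le_mul_left h2 hp
  rintro ⟨A, hA, hpos, hlim⟩
  rw [← ENNReal.tendsto_toReal_iff (fun m => measure_ne_top _ _) ENNReal.zero_ne_top] at hlim
  have := ge_of_tendsto' hlim fun m => key (A m) (hA m) (hpos m)
  simp only [ENNReal.toReal_zero] at this
  exact absurd this (not_le.2 (Real.exp_pos _))

variable (μi : ∀ i, Measure (𝒳 i))

/-- The average of `f` over the `i`-th coordinate. -/
noncomputable def coordAvg (i : Fin n) (f : (∀ j, 𝒳 j) → ℝ) (x : ∀ j, 𝒳 j) : ℝ :=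
  ∫ y, f (Function.update x i y) ∂(μi i)

/-- The successive averages of `f` over the coordinates in a list. -/
noncomputable def listAvg (l : List (Fin n)) (f : (∀ j, 𝒳 j) → ℝ) : (∀ j, 𝒳 j) → ℝ :=
  l.foldr (coordAvg μi) f

variable {μi} {f g : (∀ j, 𝒳 j) → ℝ}

theorem coordAvg_update (i : Fin n) (x : ∀ j, 𝒳 j) (y : 𝒳 i) :
    coordAvg μi i f (Function.update x i y) = coordAvg μi i f x := by
  simp [coordAvg]

theorem cVar_eq_coordAvg (i : Fin n) (x : ∀ j, 𝒳 j) :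
    cVar (μi i) (fun y => f (Function.update x i y)) =
      ∫ y, (fun z => (f z - coordAvg μi i f z) ^ 2) (Function.update x i y) ∂(μi i) := by
  simp only [cVar, coordAvg_update]
  rfl

theorem listAvg_congr (l : List (Fin n)) {x x' : ∀ j, 𝒳 j} (h : ∀ j ∉ l, x j = x' j) :
    listAvg μi l f x = listAvg μi l f x' := by
  induction l generalizing x x' with
  | nil => rw [funext fun j => h j (by simp)]
  | cons i l ih =>
    refine integral_congr_ae (Filter.Eventually.of_forall fun y => ih fun j hj => ?_)
    rcases eq_or_ne j i with rfl | hji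
    · simp
    · simpa [hji] using h j (by simp [hji, hj])

variable [∀ i, IsProbabilityMeasure (μi i)]

variable (μi) in
/-- Resampling one coordinate preserves a product probability measure. -/
theorem measurePreserving_update_pi (i : Fin n) :
    MeasurePreserving (fun p : (∀ j, 𝒳 j) × 𝒳 i => Function.update p.1 i p.2)
      ((Measure.pi μi).prod (μi i)) (Measure.pi μi) := by
  refine ⟨measurable_update', (Measure.pi_eq fun s hs => ?_).symm⟩
  have e : (fun p : (∀ j, 𝒳 j) × 𝒳 i => Function.update p.1 i p.2) ⁻¹' Set.univ.pi s =
      (Set.univ.pi (Function.update s i Set.univ)) ×ˢ s i := by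
    ext ⟨x, y⟩
    simp only [Set.mem_preimage, Set.mem_prod, Set.mem_univ_pi]
    constructor
    · refine fun H => ⟨fun j => ?_, by simpa using H i⟩
      rcases eq_or_ne j i with rfl | hj
      · simp
      · simpa [hj] using H j
    · rintro ⟨H, hy⟩ j
      rcases eq_or_ne j i with rfl | hj
      · simpa using hy
      · simpa [hj] using H j
  rw [Measure.map_apply measurable_update' (MeasurableSet.univ_pi hs), e, Measure.prod_prod,
    Measure.pi_pi, ← Finset.mul_prod_erase _ _ (Finset.mem_univ i),
    ← Finset.mul_prod_erase _ (fun j => μi j (s j)) (Finset.mem_univ i)]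
  simp only [Function.update_self, measure_univ, one_mul]
  rw [mul_comm]
  congr 1
  refine Finset.prod_congr rfl fun j hj => ?_
  rw [Function.update_of_ne (Finset.ne_of_mem_erase hj)]

variable (μi) in
theorem isCondKernel_pi : IsCondKernel (Measure.pi μi) (fun i _ => μi i) := by
  refine ⟨fun i _ => inferInstance, fun _ _ _ _ => rfl, fun i g hg hb => ?_⟩
  have hmp := measurePreserving_update_pi μi i
  have hint : Integrable (fun p : (∀ j, 𝒳 j) × 𝒳 i => g (Function.update p.1 i p.2))
      ((Measure.pi μi).prod (μi i)) :=
    integrable_of_measurable_of_abs_le (hg.comp hmp.measurable) (hb.imp fun M hM p => hM _)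
  conv_rhs => rw [← hmp.map_eq]
  rw [integral_map hmp.measurable.aemeasurable hg.aestronglyMeasurable,
    integral_prod _ hint]

theorem measurable_coordAvg (hf : Measurable f) (i : Fin n) : Measurable (coordAvg μi i f) :=
  (StronglyMeasurable.integral_prod_right'
    (f := fun p : (∀ j, 𝒳 j) × 𝒳 i => f (Function.update p.1 i p.2))
    (hf.comp measurable_update').stronglyMeasurable).measurable

theorem coordAvg_bounded (hb : ∃ M, ∀ x, |f x| ≤ M) (i : Fin n) :
    ∃ M, ∀ x, |coordAvg μi i f x| ≤ M := by
  obtain ⟨M, hM⟩ := hb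
  refine ⟨M, fun x => ?_⟩
  simpa [coordAvg] using norm_integral_le_of_norm_le_const (μ := μi i)
    (f := fun y => f (Function.update x i y)) (Filter.Eventually.of_forall fun _ => hM _)

theorem integrable_comp_update (hf : Measurable f) (hb : ∃ M, ∀ x, |f x| ≤ M) (i : Fin n)
    (x : ∀ j, 𝒳 j) : Integrable (fun y => f (Function.update x i y)) (μi i) :=
  integrable_of_measurable_of_abs_le (measurable_comp_update hf i x) (hb.imp fun _ hM _ => hM _)

/-- Averaging over a coordinate is an `L²`-contraction. -/
theorem integral_coordAvg_sub_sq_le (hf : Measurable f) (hfb : ∃ M, ∀ x, |f x| ≤ M)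
    (hg : Measurable g) (hgb : ∃ M, ∀ x, |g x| ≤ M) (i : Fin n) :
    ∫ x, (coordAvg μi i f x - coordAvg μi i g x) ^ 2 ∂Measure.pi μi ≤
      ∫ x, (f x - g x) ^ 2 ∂Measure.pi μi := by
  have hd : Measurable fun x => f x - g x := hf.sub hg
  have hdb := abs_sub_le_of_bounded hfb hgb
  have hd2 : Measurable fun x => (f x - g x) ^ 2 := hd.pow_const 2
  have hd2b := abs_sq_le_of_bounded hdb
  rw [← (isCondKernel_pi μi).2.2 i _ hd2 hd2b]
  refine integral_mono_of_nonneg (Filter.Eventually.of_forall fun x => sq_nonneg _)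
    ((isCondKernel_pi μi).integrable i hd2 hd2b) (Filter.Eventually.of_forall fun x => ?_)
  have := sq_integral_le_integral_sq (integrable_comp_update (μi := μi) hd hdb i x)
    (integrable_comp_update hd2 hd2b i x)
  rwa [integral_sub (integrable_comp_update hf hfb i x) (integrable_comp_update hg hgb i x)] at this

theorem measurable_listAvg (hf : Measurable f) (l : List (Fin n)) :
    Measurable (listAvg μi l f) := by
  induction l with
  | nil => exact hf
  | cons i l ih => exact measurable_coordAvg ih i

theorem listAvg_bounded (hb : ∃ M, ∀ x, |f x| ≤ M) (l : List (Fin n)) :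
    ∃ M, ∀ x, |listAvg μi l f x| ≤ M := by
  induction l with
  | nil => exact hb
  | cons i l ih => exact coordAvg_bounded ih i

theorem integral_sub_listAvg_sq_le (hf : Measurable f) (hb : ∃ M, ∀ x, |f x| ≤ M)
    (l : List (Fin n)) :
    ∫ x, (f x - listAvg μi l f x) ^ 2 ∂Measure.pi μi ≤
      2 ^ l.length * (l.map fun i => ∫ x, (f x - coordAvg μi i f x) ^ 2 ∂Measure.pi μi).sum := by
  induction l with
  | nil => simp [listAvg]
  | cons i l ih =>
    have hm := measurable_coordAvg (μi := μi) hf i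
    have hmb := coordAvg_bounded (μi := μi) hb i
    have hl := measurable_listAvg (μi := μi) hf (i :: l)
    have hlb := listAvg_bounded (μi := μi) hb (i :: l)
    have i1 : Integrable (fun x => (f x - coordAvg μi i f x) ^ 2) (Measure.pi μi) :=
      integrable_of_measurable_of_abs_le ((hf.sub hm).pow_const 2)
        (abs_sq_le_of_bounded (abs_sub_le_of_bounded hb hmb))
    have i2 : Integrable (fun x => (coordAvg μi i f x - listAvg μi (i :: l) f x) ^ 2)
        (Measure.pi μi) :=
      integrable_of_measurable_of_abs_le ((hm.sub hl).pow_const 2)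
        (abs_sq_le_of_bounded (abs_sub_le_of_bounded hmb hlb))
    have hcontr : ∫ x, (coordAvg μi i f x - listAvg μi (i :: l) f x) ^ 2 ∂Measure.pi μi ≤
        ∫ x, (f x - listAvg μi l f x) ^ 2 ∂Measure.pi μi :=
      integral_coordAvg_sub_sq_le hf hb (measurable_listAvg hf l) (listAvg_bounded hb l) i
    have hle : ∫ x, (f x - listAvg μi (i :: l) f x) ^ 2 ∂Measure.pi μi ≤
        ∫ x, 2 * (f x - coordAvg μi i f x) ^ 2 +
          2 * (coordAvg μi i f x - listAvg μi (i :: l) f x) ^ 2 ∂Measure.pi μi := by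
      refine integral_mono_of_nonneg (Filter.Eventually.of_forall fun x => sq_nonneg _)
        ((i1.const_mul 2).add (i2.const_mul 2)) (Filter.Eventually.of_forall fun x => ?_)
      simp only
      nlinarith [sq_nonneg ((f x - coordAvg μi i f x) -
        (coordAvg μi i f x - listAvg μi (i :: l) f x))]
    rw [integral_add (i1.const_mul 2) (i2.const_mul 2), integral_const_mul,
      integral_const_mul] at hle
    have hpow : (1 : ℝ) ≤ 2 ^ l.length := one_le_pow₀ (by norm_num)
    have hnn : 0 ≤ ∫ x, (f x - coordAvg μi i f x) ^ 2 ∂Measure.pi μi :=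
      integral_nonneg fun x => sq_nonneg _
    simp only [List.map_cons, List.sum_cons, List.length_cons, pow_succ _ l.length]
    linarith [mul_le_mul_of_nonneg_right hpow hnn]

variable (μi) in
/-- An Efron-Stein type inequality for product measures. -/
theorem exists_integral_sub_const_sq_le (hf : Measurable f) (hb : ∃ M, ∀ x, |f x| ≤ M) :
    ∃ c : ℝ, ∫ x, (f x - c) ^ 2 ∂Measure.pi μi ≤
      2 ^ n * ∫ x, dSq (fun i _ => μi i) f x ∂Measure.pi μi := by
  have : Nonempty (∀ j, 𝒳 j) := (Measure.pi μi).nonempty_of_neZero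
  obtain ⟨x₀⟩ := this
  refine ⟨listAvg μi (List.finRange n) f x₀, ?_⟩
  have hc : ∀ x, listAvg μi (List.finRange n) f x = listAvg μi (List.finRange n) f x₀ :=
    fun x => listAvg_congr _ fun j hj => absurd (List.mem_finRange j) hj
  have h := integral_sub_listAvg_sq_le (μi := μi) hf hb (List.finRange n)
  have hm : ∀ i, Measurable fun x => (f x - coordAvg μi i f x) ^ 2 :=
    fun i => (hf.sub (measurable_coordAvg hf i)).pow_const 2
  have hmb := fun i =>
    abs_sq_le_of_bounded (abs_sub_le_of_bounded hb (coordAvg_bounded (μi := μi) hb i))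
  have e : ∫ x, dSq (fun i _ => μi i) f x ∂Measure.pi μi =
      ∑ i, ∫ x, (f x - coordAvg μi i f x) ^ 2 ∂Measure.pi μi := by
    simp only [dSq, cVar_eq_coordAvg]
    rw [integral_finsetSum _ fun i _ => (isCondKernel_pi μi).integrable i (hm i) (hmb i)]
    exact Finset.sum_congr rfl fun i _ => (isCondKernel_pi μi).2.2 i _ (hm i) (hmb i)
  simp only [hc, List.length_finRange] at h
  rwa [e, ← List.sum_ofFn, List.ofFn_eq_map]

end

/-- (i) a `𝔡`-LSI forces finite support; (ii) for product measures the
`𝔡`-LSI property is equivalent to finite support (Proposition `d-LSIs`). -/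
theorem stmt17 {n : ℕ} {𝒳 : Fin n → Type*} [∀ i, TopologicalSpace (𝒳 i)]
    [∀ i, PolishSpace (𝒳 i)] [∀ i, MeasurableSpace (𝒳 i)] [∀ i, BorelSpace (𝒳 i)] :
    (∀ (μ : Measure (∀ i, 𝒳 i)), IsProbabilityMeasure μ →
      (∃ ν σ2, 0 < σ2 ∧ DLSI μ ν σ2) → FinSupport μ) ∧
    (∀ (μi : ∀ i, Measure (𝒳 i)), (∀ i, IsProbabilityMeasure (μi i)) →
      ((∃ ν σ2, 0 < σ2 ∧ DLSI (Measure.pi μi) ν σ2) ↔ FinSupport (Measure.pi μi))) := by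
  refine ⟨fun μ hμ ⟨ν, σ2, hσ, h⟩ => h.finSupport hσ, fun μi hμi => ⟨fun ⟨ν, σ2, hσ, h⟩ => h.finSupport hσ,
    fun h => ?_⟩⟩
  obtain ⟨K, hK, hent⟩ := h.exists_ent_sq_le
  refine ⟨fun i _ => μi i, K * 2 ^ n, by positivity, isCondKernel_pi μi, fun f hf hb => ?_⟩
  obtain ⟨c, hc⟩ := exists_integral_sub_const_sq_le μi hf hb
  calc ent (Measure.pi μi) (fun x => f x ^ 2) ≤ K * ∫ x, (f x - c) ^ 2 ∂Measure.pi μi :=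
        hent f hf hb c
    _ ≤ K * (2 ^ n * ∫ x, dSq (fun i _ => μi i) f x ∂Measure.pi μi) := by gcongr
    _ ≤ 2 * (K * 2 ^ n) * ∫ x, dSq (fun i _ => μi i) f x ∂Measure.pi μi := by
        have h0 : 0 ≤ ∫ x, dSq (fun i _ => μi i) f x ∂Measure.pi μi :=
          integral_nonneg fun x => Finset.sum_nonneg fun i _ => integral_nonneg fun y => sq_nonneg _
        have : 0 ≤ K * 2 ^ n * ∫ x, dSq (fun i _ => μi i) f x ∂Measure.pi μi := by positivity
        linarith
end
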